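/- Let ℓ ≥ 2, b ≥ 1, and r ≥ 1. There is a constant c (depending only on ℓ, b, r) with the following property. Let M be an m-rowed 3-matrix such that: (i) there are no two columns i, j of M and b rows on which column i has entry 1 and column j has entry 0 (i.e., M has no b×2 submatrix [𝟏_b 𝟎_b]); (ii) whenever i < j, column i of M contains strictly more 1's than column j; (iii) M contains no member of 𝒯_ℓ(3) \ 𝒯_ℓ(2) as a configuration. If M has more than c columns, then there exist rows i₁ < i₂ < ⋯ < i_r and columns j₁ < j₂ < ⋯ < j_r of M such that M(i_a, j_a) = 1 for all a and M(i_a, j_b) = 2 for all b < a (an r×r submatrix with 1's on the diagonal and 2's below the diagonal). -/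

import Mathlib

/-- A matrix with natural number entries, of size `k × p`. -/
abbrev MatN (k p : ℕ) := Matrix (Fin k) (Fin p) ℕ

/-- A matrix bundled with its dimensions. -/
structure CMat where
  rows : ℕ
  cols : ℕ
  mat : MatN rows cols

/-- A matrix is simple if no two of its columns are equal. -/
def SimpleM {m n : ℕ} (A : MatN m n) : Prop :=
  ∀ j₁ j₂ : Fin n, (∀ i, A i j₁ = A i j₂) → j₁ = j₂

/-- An `r`-matrix: all entries lie in `{0, 1, …, r-1}`. -/
def RMat (r : ℕ) {m n : ℕ} (A : MatN m n) : Prop := ∀ i j, A i j < r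

/-- `F` is a configuration of `A` (written `F ≺ A`): some submatrix of `A` is a row
and column permutation of `F`; equivalently there are injections of the rows and
columns of `F` into those of `A` realizing the entries of `F`. -/
def IsConfig {k p m n : ℕ} (F : MatN k p) (A : MatN m n) : Prop :=
  ∃ f : Fin k → Fin m, ∃ g : Fin p → Fin n,
    Function.Injective f ∧ Function.Injective g ∧ ∀ i j, A (f i) (g j) = F i j

/-- `A` avoids every matrix of the family `𝓕` as a configuration. -/
def AvoidsFam {m n : ℕ} (A : MatN m n) (𝓕 : Set CMat) : Prop :=
  ∀ F ∈ 𝓕, ¬ IsConfig F.mat A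

/-- `forb m r 𝓕`: the maximum number of columns of an `m`-rowed simple `r`-matrix
having no member of `𝓕` as a configuration. -/
noncomputable def forb (m r : ℕ) (𝓕 : Set CMat) : ℕ :=
  sSup { n : ℕ | ∃ A : MatN m n, RMat r A ∧ SimpleM A ∧ AvoidsFam A 𝓕 }

/-- `forbmax m r 𝓕`: the maximum of `forb m' r 𝓕` over `m' ≤ m`. -/
noncomputable def forbmax (m r : ℕ) (𝓕 : Set CMat) : ℕ :=
  sSup { x : ℕ | ∃ m' ≤ m, x = forb m' r 𝓕 }

/-- The number of 1's in column `j` of `A` (the column sum). -/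
def colSum {m n : ℕ} (A : MatN m n) (j : Fin n) : ℕ :=
  (Finset.univ.filter (fun i => A i j = 1)).card

/-- `forbK k m r 𝓕`: as `forb`, but restricted to matrices all of whose columns
have exactly `k` entries equal to 1. -/
noncomputable def forbK (k m r : ℕ) (𝓕 : Set CMat) : ℕ :=
  sSup { n : ℕ | ∃ A : MatN m n, RMat r A ∧ SimpleM A ∧ (∀ j, colSum A j = k) ∧
    AvoidsFam A 𝓕 }

/-- `forbmaxK k m r 𝓕`: the maximum of `forbK k m' r 𝓕` over `m' ≤ m`. -/
noncomputable def forbmaxK (k m r : ℕ) (𝓕 : Set CMat) : ℕ :=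
  sSup { x : ℕ | ∃ m' ≤ m, x = forbK k m' r 𝓕 }

/-- `Imat ℓ a b`: the `ℓ × ℓ` matrix with `a` on the diagonal and `b` off the diagonal. -/
def Imat (ℓ a b : ℕ) : MatN ℓ ℓ := fun i j => if i = j then a else b

/-- `Tmat ℓ a b`: the `ℓ × ℓ` matrix with `a` below the diagonal and `b` on or above it. -/
def Tmat (ℓ a b : ℕ) : MatN ℓ ℓ := fun i j => if (j : ℕ) < (i : ℕ) then a else b

/-- `Tmat3 ℓ a b c`: the `ℓ × ℓ` matrix with `a` below, `b` on, and `c` above the diagonal. -/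
def Tmat3 (ℓ a b c : ℕ) : MatN ℓ ℓ :=
  fun i j => if (j : ℕ) < (i : ℕ) then a else if i = j then b else c

/-- The family `𝒯_ℓ(r)` of all `I_ℓ(a,b)` and `T_ℓ(a,b)` with `a,b ∈ {0,…,r-1}`, `a ≠ b`. -/
def TFam (ℓ r : ℕ) : Set CMat :=
  { M | ∃ a b : ℕ, a < r ∧ b < r ∧ a ≠ b ∧
      (M = ⟨ℓ, ℓ, Imat ℓ a b⟩ ∨ M = ⟨ℓ, ℓ, Tmat ℓ a b⟩) }

/-- `t·F`: the concatenation of `t` copies of `F` side by side. -/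
def tcopies {k p : ℕ} (t : ℕ) (F : MatN k p) : MatN k (t * p) :=
  fun i j => F i ⟨(j : ℕ) % p, Nat.mod_lt _ (by
    rcases Nat.eq_zero_or_pos p with h | h
    · exact absurd j.isLt (by simp [h])
    · exact h)⟩

/-- `0×1×F`: `F` with an extra row of 0's and an extra row of 1's appended. -/
def zeroOneTop {k p : ℕ} (F : MatN k p) : MatN (k + 2) p :=
  fun i j => if h : (i : ℕ) < k then F ⟨i, h⟩ j else if (i : ℕ) = k then 0 else 1

/-- `F_{a,b,c,d}`: the `(a+b+c+d) × 2` matrix with `a` rows `[1 1]`, `b` rows `[1 0]`,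
`c` rows `[0 1]` and `d` rows `[0 0]`. -/
def Fabcd (a b c d : ℕ) : MatN (a + b + c + d) 2 :=
  fun i j =>
    if (i : ℕ) < a then 1
    else if (i : ℕ) < a + b then (if (j : ℕ) = 0 then 1 else 0)
    else if (i : ℕ) < a + b + c then (if (j : ℕ) = 0 then 0 else 1)
    else 0

theorem ultra_lim {κ : Type} [Finite κ] (g : ℕ → κ) :
    ∃ c, ∀ᶠ n in (Filter.hyperfilter ℕ : Filter ℕ), g n = c := by
  obtain ⟨c, hc⟩ := Ultrafilter.eq_pure_of_finite ((Filter.hyperfilter ℕ).map g)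
  refine ⟨c, ?_⟩
  have h : ({c} : Set κ) ∈ (Filter.hyperfilter ℕ).map g := by
    rw [hc]; exact Ultrafilter.mem_pure.2 rfl
  exact h

theorem ultra_gt (N : ℕ) : ∀ᶠ n in (Filter.hyperfilter ℕ : Filter ℕ), N < n :=
  Nat.hyperfilter_le_atTop (Filter.eventually_gt_atTop N)

/-- Ramsey's theorem for triples, via ultrafilters. -/
theorem ramsey3 {κ : Type} [Finite κ] (K : ℕ) :
    ∃ N : ℕ, ∀ f : ℕ → ℕ → ℕ → κ, ∃ s : Finset ℕ, s.card = K ∧ (∀ x ∈ s, x < N) ∧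
      ∃ c, ∀ i ∈ s, ∀ j ∈ s, ∀ k ∈ s, i < j → j < k → f i j k = c := by
  by_contra hcon
  push Not at hcon
  choose F hF using hcon
  choose f hf using fun i j k => ultra_lim (fun n => F n i j k)
  choose f2 hf2 using fun i j => ultra_lim (fun k => f i j k)
  choose f1 hf1 using fun i => ultra_lim (fun j => f2 i j)
  obtain ⟨c, hc⟩ := ultra_lim f1
  have key : ∀ K : ℕ, ∃ s : Finset ℕ, s.card = K ∧ (∀ i ∈ s, f1 i = c) ∧
      (∀ i ∈ s, ∀ j ∈ s, i < j → f2 i j = c) ∧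
      (∀ i ∈ s, ∀ j ∈ s, ∀ k ∈ s, i < j → j < k → f i j k = c) := by
    intro K
    induction K with
    | zero => exact ⟨∅, by simp⟩
    | succ K ih =>
      obtain ⟨s, hs, h1, h2, h3⟩ := ih
      have e2 : ∀ᶠ n in (Filter.hyperfilter ℕ : Filter ℕ), ∀ i ∈ s, f2 i n = c := by
        rw [Filter.eventually_all_finset]
        intro i hi
        rw [← h1 i hi]; exact hf1 i
      have e3 : ∀ᶠ n in (Filter.hyperfilter ℕ : Filter ℕ),
          ∀ i ∈ s, ∀ j ∈ s, i < j → f i j n = c := by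
        rw [Filter.eventually_all_finset]
        intro i hi
        rw [Filter.eventually_all_finset]
        intro j hj
        by_cases hij : i < j
        · filter_upwards [hf2 i j] with n hn _
          rw [hn]; exact h2 i hi j hj hij
        · exact Filter.Eventually.of_forall fun n h => absurd h hij
      have e4 : ∀ᶠ n in (Filter.hyperfilter ℕ : Filter ℕ), ∀ i ∈ s, i < n := by
        rw [Filter.eventually_all_finset]
        intro i _
        exact ultra_gt i
      obtain ⟨n, n1, n2, n3, n4⟩ := (hc.and (e2.and (e3.and e4))).exists
      have hn : n ∉ s := fun h => lt_irrefl _ (n4 n h)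
      refine ⟨insert n s, by rw [Finset.card_insert_of_notMem hn, hs], ?_, ?_, ?_⟩
      · intro i hi
        rcases Finset.mem_insert.1 hi with rfl | hi
        · exact n1
        · exact h1 i hi
      · intro i hi j hj hij
        rcases Finset.mem_insert.1 hi with hi2 | hi2
        · rcases Finset.mem_insert.1 hj with hj2 | hj2
          · omega
          · have := n4 j hj2; omega
        · rcases Finset.mem_insert.1 hj with hj2 | hj2
          · rw [hj2]; exact n2 i hi2
          · exact h2 i hi2 j hj2 hij
      · intro i hi j hj k hk hij hjk
        have hj' : j ∈ s := by
          rcases Finset.mem_insert.1 hj with rfl | hj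
          · rcases Finset.mem_insert.1 hk with rfl | hk
            · omega
            · have := n4 k hk; omega
          · exact hj
        have hi' : i ∈ s := by
          rcases Finset.mem_insert.1 hi with rfl | hi
          · have := n4 j hj'; omega
          · exact hi
        rcases Finset.mem_insert.1 hk with rfl | hk
        · exact n3 i hi' j hj' hij
        · exact h3 i hi' j hj' k hk hij hjk
  obtain ⟨s, hs, -, -, h3⟩ := key K
  have e1 : ∀ᶠ n in (Filter.hyperfilter ℕ : Filter ℕ),
      ∀ i ∈ s, ∀ j ∈ s, ∀ k ∈ s, F n i j k = f i j k := by
    simp only [Filter.eventually_all_finset]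
    intro i _ j _ k _
    exact hf i j k
  have e4 : ∀ᶠ n in (Filter.hyperfilter ℕ : Filter ℕ), ∀ i ∈ s, i < n := by
    rw [Filter.eventually_all_finset]
    intro i _
    exact ultra_gt i
  obtain ⟨n, n1, n2⟩ := (e1.and e4).exists
  obtain ⟨i, hi, j, hj, k, hk, hij, hjk, hne⟩ := hF n s hs n2 c
  exact hne (by rw [n1 i hi j hj k hk]; exact h3 i hi j hj k hk hij hjk)

theorem noT {ℓ m n : ℕ} (hℓ : 2 ≤ ℓ) (M : MatN m n)
    (hM : AvoidsFam M (TFam ℓ 3 \ TFam ℓ 2)) (R : ℕ → Fin m) (C : ℕ → Fin n) (u v : ℕ)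
    (hu : u < 3) (hv : v < 3) (huv : u ≠ v) (h2 : u = 2 ∨ v = 2)
    (hlow : ∀ i j, i < ℓ → j < i → M (R i) (C j) = u)
    (hup : ∀ i j, j < ℓ → i ≤ j → M (R i) (C j) = v) : False := by
  refine hM ⟨ℓ, ℓ, Tmat ℓ u v⟩ ⟨⟨u, v, hu, hv, huv, Or.inr rfl⟩, ?_⟩
    ⟨fun i => R i, fun j => C j, ?_, ?_, ?_⟩
  · rintro ⟨a, b, ha, hb, hab, h | h⟩
    · injection h with _ _ h
      have h00 := congrFun (congrFun h ⟨0, by omega⟩) ⟨0, by omega⟩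
      have h10 := congrFun (congrFun h ⟨1, by omega⟩) ⟨0, by omega⟩
      simp [Tmat, Imat] at h00 h10
      omega
    · injection h with _ _ h
      have h00 := congrFun (congrFun h ⟨0, by omega⟩) ⟨0, by omega⟩
      have h10 := congrFun (congrFun h ⟨1, by omega⟩) ⟨0, by omega⟩
      simp [Tmat] at h00 h10
      omega
  · have key : ∀ i i' : Fin ℓ, i < i' → R i ≠ R i' := by
      intro i i' hlt he
      have a1 := hup i i i.2 le_rfl
      have a2 := hlow i' i i'.2 hlt
      rw [he, a2] at a1
      exact huv a1
    intro i i' he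
    rcases lt_trichotomy i i' with h | h | h
    · exact absurd he (key _ _ h)
    · exact h
    · exact absurd he.symm (key _ _ h)
  · have key : ∀ i i' : Fin ℓ, i < i' → C i ≠ C i' := by
      intro i i' hlt he
      have a1 := hup i' i' i'.2 le_rfl
      have a2 := hlow i' i i'.2 hlt
      rw [← he, a2] at a1
      exact huv a1
    intro i i' he
    rcases lt_trichotomy i i' with h | h | h
    · exact absurd he (key _ _ h)
    · exact h
    · exact absurd he.symm (key _ _ h)
  · intro i j
    simp only [Tmat]
    split_ifs with h
    · exact hlow i j i.2 h
    · exact hup i j j.2 (by omega)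

theorem noI {ℓ m n : ℕ} (hℓ : 2 ≤ ℓ) (M : MatN m n)
    (hM : AvoidsFam M (TFam ℓ 3 \ TFam ℓ 2)) (R : ℕ → Fin m) (C : ℕ → Fin n) (u v : ℕ)
    (hu : u < 3) (hv : v < 3) (huv : u ≠ v) (h2 : u = 2 ∨ v = 2)
    (hdiag : ∀ i, i < ℓ → M (R i) (C i) = u)
    (hoff : ∀ i j, i < ℓ → j < ℓ → i ≠ j → M (R i) (C j) = v) : False := by
  refine hM ⟨ℓ, ℓ, Imat ℓ u v⟩ ⟨⟨u, v, hu, hv, huv, Or.inl rfl⟩, ?_⟩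
    ⟨fun i => R i, fun j => C j, ?_, ?_, ?_⟩
  · rintro ⟨a, b, ha, hb, hab, h | h⟩
    · injection h with _ _ h
      have h00 := congrFun (congrFun h ⟨0, by omega⟩) ⟨0, by omega⟩
      have h10 := congrFun (congrFun h ⟨1, by omega⟩) ⟨0, by omega⟩
      simp [Imat] at h00 h10
      omega
    · injection h with _ _ h
      have h00 := congrFun (congrFun h ⟨0, by omega⟩) ⟨0, by omega⟩
      have h10 := congrFun (congrFun h ⟨1, by omega⟩) ⟨0, by omega⟩
      simp [Tmat, Imat] at h00 h10
      omega
  · intro i i' he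
    by_contra hne
    have a1 := hdiag i i.2
    have a2 := hoff i' i i'.2 i.2 (fun h => hne (Fin.ext h.symm))
    have he : R i = R i' := he
    rw [he, a2] at a1
    exact huv a1.symm
  · intro i i' he
    by_contra hne
    have a1 := hdiag i i.2
    have a2 := hoff i i' i.2 i'.2 (fun h => hne (Fin.ext h))
    have he : C i = C i' := he
    rw [he, a2] at a1
    exact huv a1.symm
  · intro i j
    simp only [Imat]
    split_ifs with h
    · subst h; exact hdiag i i.2
    · exact hoff i j i.2 j.2 (fun h' => h (Fin.ext h'))

/-- A homogeneous pattern with diagonal `d`, `u` below and `v` above. -/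
theorem noD {ℓ m n : ℕ} (hℓ : 2 ≤ ℓ) (M : MatN m n)
    (hM : AvoidsFam M (TFam ℓ 3 \ TFam ℓ 2)) (R : ℕ → Fin m) (C : ℕ → Fin n) (d u v : ℕ)
    (hd : d < 3) (hu : u < 3) (hv : v < 3)
    (h : (u ≠ v ∧ (u = 2 ∨ v = 2)) ∨ (u = v ∧ d ≠ v ∧ (d = 2 ∨ v = 2)))
    (hdiag : ∀ i, i < 2 * ℓ → M (R i) (C i) = d)
    (hlow : ∀ i j, i < 2 * ℓ → j < i → M (R i) (C j) = u)
    (hup : ∀ i j, j < 2 * ℓ → i < j → M (R i) (C j) = v) : False := by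
  rcases h with ⟨h1, h2⟩ | ⟨rfl, h1, h2⟩
  · refine noT hℓ M hM (fun i => R (2 * i)) (fun j => C (2 * j + 1)) u v hu hv h1 h2 ?_ ?_
    · intro i j hi hj
      exact hlow _ _ (by omega) (by omega)
    · intro i j hi hj
      exact hup _ _ (by omega) (by omega)
  · refine noI hℓ M hM R C d u hd hv h1 h2 (fun i hi => hdiag i (by omega)) ?_
    intro i j hi hj hij
    rcases lt_or_gt_of_ne hij with h | h
    · exact hup _ _ (by omega) h
    · exact hlow _ _ (by omega) h

theorem core {ℓ b m n : ℕ} (hℓ : 2 ≤ ℓ) (M : MatN m n)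
    (hi : ¬ ∃ (f : Fin b → Fin m) (j₁ j₂ : Fin n), Function.Injective f ∧ j₁ < j₂ ∧
          ∀ a : Fin b, M (f a) j₁ = 1 ∧ M (f a) j₂ = 0)
    (hM : AvoidsFam M (TFam ℓ 3 \ TFam ℓ 2))
    (K : ℕ) (hK : K = 4 * ℓ + b + 4) (C : ℕ → Fin n) (ρ : ℕ → ℕ → Fin m)
    (hC : ∀ i j, i < j → j < K → C i < C j)
    (x y z : ℕ) (hx : x < 3) (hy : y < 3) (hz : z < 3)
    (h1 : ∀ i j, i < j → j < K → M (ρ i j) (C i) = 1)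
    (h2 : ∀ i j, i < j → j < K → M (ρ i j) (C j) = 2)
    (hhx : ∀ k i j, k < i → i < j → j < K → M (ρ i j) (C k) = x)
    (hhy : ∀ i k j, i < k → k < j → j < K → M (ρ i j) (C k) = y)
    (hhz : ∀ i j k, i < j → j < k → k < K → M (ρ i j) (C k) = z) : False := by
  -- consecutive pairs, first columns
  have A1 : ¬ ((x ≠ z ∧ (x = 2 ∨ z = 2)) ∨ (x = z ∧ 1 ≠ z ∧ (1 = 2 ∨ z = 2))) := fun h =>
    noD hℓ M hM (fun a => ρ (2 * a) (2 * a + 1)) (fun a => C (2 * a)) 1 x z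
      (by omega) hx hz h
      (fun i hi => h1 _ _ (by omega) (by omega))
      (fun i j hi hj => hhx _ _ _ (by omega) (by omega) (by omega))
      (fun i j hi hj => hhz _ _ _ (by omega) (by omega) (by omega))
  have A2 : ¬ ((x ≠ z ∧ (x = 2 ∨ z = 2)) ∨ (x = z ∧ 2 ≠ z ∧ (2 = 2 ∨ z = 2))) := fun h =>
    noD hℓ M hM (fun a => ρ (2 * a) (2 * a + 1)) (fun a => C (2 * a + 1)) 2 x z
      (by omega) hx hz h
      (fun i hi => h2 _ _ (by omega) (by omega))
      (fun i j hi hj => hhx _ _ _ (by omega) (by omega) (by omega))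
      (fun i j hi hj => hhz _ _ _ (by omega) (by omega) (by omega))
  have A3 : ¬ ((y ≠ z ∧ (y = 2 ∨ z = 2)) ∨ (y = z ∧ 2 ≠ z ∧ (2 = 2 ∨ z = 2))) := fun h =>
    noD hℓ M hM (fun a => ρ 0 (a + 1)) (fun a => C (a + 1)) 2 y z
      (by omega) hy hz h
      (fun i hi => h2 _ _ (by omega) (by omega))
      (fun i j hi hj => hhy _ _ _ (by omega) (by omega) (by omega))
      (fun i j hi hj => hhz _ _ _ (by omega) (by omega) (by omega))
  have hcases : (x = 1 ∧ z = 0) ∨ (x = 0 ∧ z = 1 ∧ y = 0) := by omega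
  rcases hcases with ⟨rfl, rfl⟩ | ⟨rfl, rfl, rfl⟩
  · refine hi ⟨fun a => ρ (a + 1) (a + 2), C 0, C (b + 3), ?_, hC _ _ (by omega) (by omega), ?_⟩
    · have key : ∀ a a' : Fin b, a < a' → ρ (a + 1) (a + 2) ≠ ρ (a' + 1) (a' + 2) := by
        intro a a' hlt he
        have hlt : (a : ℕ) < a' := hlt
        have ha' := a'.2
        have e1 := h2 (a + 1) (a + 2) (by omega) (by omega)
        rw [he] at e1
        rcases Nat.lt_or_ge (a + 2) (a' + 1) with h | h
        · have := hhx (a + 2) (a' + 1) (a' + 2) h (by omega) (by omega)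
          omega
        · have e2 := h1 (a' + 1) (a' + 2) (by omega) (by omega)
          have e3 : (a' : ℕ) + 1 = a + 2 := by omega
          rw [← e3] at e1
          omega
      intro a a' he
      rcases lt_trichotomy a a' with h | h | h
      · exact absurd he (key _ _ h)
      · exact h
      · exact absurd he.symm (key _ _ h)
    · intro a
      have ha := a.2
      exact ⟨hhx _ _ _ (by omega) (by omega) (by omega),
        hhz _ _ _ (by omega) (by omega) (by omega)⟩
  · refine hi ⟨fun a => ρ 0 (a + 2), C 0, C 1, ?_, hC _ _ (by omega) (by omega), ?_⟩
    · have key : ∀ a a' : Fin b, a < a' → ρ 0 (a + 2) ≠ ρ 0 (a' + 2) := by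
        intro a a' hlt he
        have hlt : (a : ℕ) < a' := hlt
        have ha' := a'.2
        have e1 := h2 0 (a + 2) (by omega) (by omega)
        rw [he] at e1
        have := hhy 0 (a + 2) (a' + 2) (by omega) (by omega) (by omega)
        omega
      intro a a' he
      rcases lt_trichotomy a a' with h | h | h
      · exact absurd he (key _ _ h)
      · exact h
      · exact absurd he.symm (key _ _ h)
    · intro a
      have ha := a.2
      exact ⟨h1 _ _ (by omega) (by omega),
        hhy _ _ _ (by omega) (by omega) (by omega)⟩

theorem exists_one_two {b m n : ℕ} (M : MatN m n) (h3 : RMat 3 M)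
    (hi : ¬ ∃ (f : Fin b → Fin m) (j₁ j₂ : Fin n), Function.Injective f ∧ j₁ < j₂ ∧
          ∀ a : Fin b, M (f a) j₁ = 1 ∧ M (f a) j₂ = 0)
    (j₁ j₂ : Fin n) (hj : j₁ < j₂) (hs : colSum M j₂ + b ≤ colSum M j₁) :
    ∃ i, M i j₁ = 1 ∧ M i j₂ = 2 := by
  by_contra hcon
  push Not at hcon
  apply hi
  set S := (Finset.univ.filter (fun i => M i j₁ = 1)) \
    (Finset.univ.filter (fun i => M i j₂ = 1)) with hS
  have hc : b ≤ S.card := by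
    have := Finset.le_card_sdiff (Finset.univ.filter (fun i => M i j₂ = 1))
      (Finset.univ.filter (fun i => M i j₁ = 1))
    unfold colSum at hs
    exact le_trans (by omega) this
  obtain ⟨T, hT, hTc⟩ := Finset.exists_subset_card_eq hc
  refine ⟨fun a => T.orderEmbOfFin hTc a, j₁, j₂, (T.orderEmbOfFin hTc).injective, hj, ?_⟩
  intro a
  have hm := hT (T.orderEmbOfFin_mem hTc a)
  simp only [hS, Finset.mem_sdiff, Finset.mem_filter, Finset.mem_univ, true_and] at hm
  have q1 := hcon _ hm.1
  have q2 := h3 (T.orderEmbOfFin hTc a) j₂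
  refine ⟨hm.1, ?_⟩
  have q3 := hm.2
  show M (T.orderEmbOfFin hTc a) j₂ = 0
  generalize M (T.orderEmbOfFin hTc a) j₂ = w at *
  omega

theorem colSum_gap {m n : ℕ} (M : MatN m n)
    (hs : ∀ j₁ j₂ : Fin n, j₁ < j₂ → colSum M j₂ < colSum M j₁) (d : ℕ) :
    ∀ j₁ j₂ : Fin n, (j₁ : ℕ) + d ≤ j₂ → colSum M j₂ + d ≤ colSum M j₁ := by
  induction d with
  | zero =>
    intro j₁ j₂ h
    rcases Nat.lt_or_ge j₁ j₂ with h' | h'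
    · exact (hs j₁ j₂ h').le
    · have : j₁ = j₂ := Fin.ext (by omega)
      rw [this]; omega
  | succ d ih =>
    intro j₁ j₂ h
    have h2 := j₂.2
    have a1 := ih ⟨j₁ + 1, by omega⟩ j₂ (by simp only; omega)
    have a2 := hs j₁ ⟨j₁ + 1, by omega⟩ (by rw [Fin.lt_def]; simp only; omega)
    omega

theorem bounded_cols (ℓ b : ℕ) (hℓ : 2 ≤ ℓ) (hb : 1 ≤ b) :
    ∃ c : ℕ, ∀ (m n : ℕ) (M : MatN m n), RMat 3 M →
      (¬ ∃ (f : Fin b → Fin m) (j₁ j₂ : Fin n), Function.Injective f ∧ j₁ < j₂ ∧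
          ∀ a : Fin b, M (f a) j₁ = 1 ∧ M (f a) j₂ = 0) →
      (∀ j₁ j₂ : Fin n, j₁ < j₂ → colSum M j₂ < colSum M j₁) →
      AvoidsFam M (TFam ℓ 3 \ TFam ℓ 2) →
      c < n → False := by
  obtain ⟨N, hN⟩ := ramsey3 (κ := Fin 3 × Fin 3 × Fin 3) (4 * ℓ + b + 4)
  refine ⟨b * N + b, ?_⟩
  intro m n M h3 hi hs hM hn
  have hpos : 0 < n := by omega
  have hbd : ∀ i, i < N → b * i < n := fun i h => by
    have := Nat.mul_le_mul_left b h.le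
    omega
  let D : ℕ → Fin n := fun i => ⟨b * i % n, Nat.mod_lt _ hpos⟩
  have hD : ∀ i, i < N → (D i : ℕ) = b * i := fun i h => Nat.mod_eq_of_lt (hbd i h)
  have hDlt : ∀ i j, i < j → j < N → (D i : ℕ) + b ≤ D j := by
    intro i j hij hj
    rw [hD i (by omega), hD j hj]
    have := Nat.mul_le_mul_left b (Nat.succ_le_of_lt hij)
    rw [Nat.mul_succ] at this
    exact this
  have hDlt' : ∀ i j, i < j → j < N → D i < D j := by
    intro i j hij hj
    have := hDlt i j hij hj
    rw [Fin.lt_def]; omega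
  have hex : ∀ i j, i < j → j < N → ∃ p, M p (D i) = 1 ∧ M p (D j) = 2 := by
    intro i j hij hj
    exact exists_one_two M h3 hi _ _ (hDlt' i j hij hj) (colSum_gap M hs b _ _ (hDlt i j hij hj))
  have hm : 0 < m := by
    by_contra h0
    have := hs ⟨0, by omega⟩ ⟨1, by omega⟩ (by simp)
    have h0 : m = 0 := by omega
    subst h0
    simp [colSum] at this
  have hex' : ∀ i j, ∃ p, i < j → j < N → M p (D i) = 1 ∧ M p (D j) = 2 := by
    intro i j
    by_cases h : i < j ∧ j < N
    · obtain ⟨p, hp⟩ := hex i j h.1 h.2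
      exact ⟨p, fun _ _ => hp⟩
    · exact ⟨⟨0, hm⟩, fun h1 h2 => absurd ⟨h1, h2⟩ h⟩
  choose ρ hρ using hex'
  let E : ℕ → ℕ → ℕ → Fin 3 := fun i j k => ⟨M (ρ i j) (D k), h3 _ _⟩
  obtain ⟨s, hsc, hsN, ⟨x, y, z⟩, hc⟩ := hN (fun i j k => (E j k i, E i k j, E i j k))
  let g : ℕ → ℕ := fun a => if h : a < 4 * ℓ + b + 4 then s.orderEmbOfFin hsc ⟨a, h⟩ else 0
  have hg : ∀ a, a < 4 * ℓ + b + 4 → g a ∈ s := by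
    intro a ha
    simp only [g, ha, dif_pos]
    exact s.orderEmbOfFin_mem hsc _
  have hgl : ∀ a a', a < a' → a' < 4 * ℓ + b + 4 → g a < g a' := by
    intro a a' h h'
    simp only [g, h', h.trans h', dif_pos]
    exact (s.orderEmbOfFin hsc).strictMono (by rw [Fin.lt_def]; exact h)
  have hgN : ∀ a, a < 4 * ℓ + b + 4 → g a < N := fun a ha => hsN _ (hg a ha)
  have tri : ∀ i j k, i < j → j < k → k < 4 * ℓ + b + 4 →
      M (ρ (g j) (g k)) (D (g i)) = x ∧ M (ρ (g i) (g k)) (D (g j)) = y ∧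
      M (ρ (g i) (g j)) (D (g k)) = z := by
    intro i j k hij hjk hk
    have := hc _ (hg i (by omega)) _ (hg j (by omega)) _ (hg k hk)
      (hgl _ _ hij (by omega)) (hgl _ _ hjk hk)
    simp only [Prod.mk.injEq, E, Fin.ext_iff] at this
    exact this
  exact core hℓ M hi hM _ rfl (fun a => D (g a)) (fun a a' => ρ (g a) (g a'))
    (fun i j hij hj => hDlt' _ _ (hgl _ _ hij hj) (hgN _ hj))
    x y z x.2 y.2 z.2
    (fun i j hij hj => (hρ _ _ (hgl _ _ hij hj) (hgN _ hj)).1)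
    (fun i j hij hj => (hρ _ _ (hgl _ _ hij hj) (hgN _ hj)).2)
    (fun k i j a1 a2 a3 => (tri k i j a1 a2 a3).1)
    (fun i k j a1 a2 a3 => (tri i k j a1 a2 a3).2.1)
    (fun i j k a1 a2 a3 => (tri i j k a1 a2 a3).2.2)

/-- For `ℓ ≥ 2`, `b ≥ 1`, `r ≥ 1`, there is a constant `c` such that
every `m`-rowed 3-matrix `M` with (i) no `b×2` submatrix `[𝟏_b 𝟎_b]`, (ii) strictly
decreasing column sums, and (iii) avoiding `𝒯_ℓ(3) \ 𝒯_ℓ(2)`, that has more than `c`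
columns contains an `r×r` submatrix with 1's on the diagonal and 2's below it. -/
theorem stmt16 (ℓ b r : ℕ) (hℓ : 2 ≤ ℓ) (hb : 1 ≤ b) (hr : 1 ≤ r) :
    ∃ c : ℕ, ∀ (m n : ℕ) (M : MatN m n), RMat 3 M →
      (¬ ∃ (f : Fin b → Fin m) (j₁ j₂ : Fin n), Function.Injective f ∧ j₁ < j₂ ∧
          ∀ a : Fin b, M (f a) j₁ = 1 ∧ M (f a) j₂ = 0) →
      (∀ j₁ j₂ : Fin n, j₁ < j₂ → colSum M j₂ < colSum M j₁) →
      AvoidsFam M (TFam ℓ 3 \ TFam ℓ 2) →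
      c < n →
      ∃ (f : Fin r → Fin m) (g : Fin r → Fin n), StrictMono f ∧ StrictMono g ∧
        (∀ a : Fin r, M (f a) (g a) = 1) ∧
        (∀ a a' : Fin r, a' < a → M (f a) (g a') = 2) := by
  obtain ⟨c, hc⟩ := bounded_cols ℓ b hℓ hb
  exact ⟨c, fun m n M h3 hi hs hM hn => (hc m n M h3 hi hs hM hn).elim⟩
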